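/- Let s be a non-empty string and suppose the family S(s,·) satisfies Eq.(★) for s. Let v' = prepal(s,1), the longest palindromic prefix of s, and let s' = s[2..|s|]. Define, for each non-empty palindromic substring v of s': S(s',v) = {x−1 : x ∈ (S(s,v) \ {1}) ∪ {|v'| − |link(v')| + 1}} if v = link(v') and |link(v')| ≥ 1, and S(s',v) = {x−1 : x ∈ S(s,v) \ {1}} otherwise. Then the family S(s',·) satisfies Eq.(★) for s'. -/

import Mathlib

noncomputable section
open scoped Classical

namespace DEE

variable {α : Type*}

/-- 1-indexed substring `s[i..j]` (empty if `i > j`). -/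
def substr (s : List α) (i j : ℕ) : List α := (s.drop (i - 1)).take (j + 1 - i)

/-- Set of start positions (1-indexed) of occurrences of `t` in `s`. -/
def occ (s t : List α) : Set ℕ :=
  {i | 1 ≤ i ∧ i + t.length - 1 ≤ s.length ∧ (s.drop (i - 1)).take t.length = t}

/-- `v` is a non-empty palindromic substring of `s`. -/
def IsPalSub (s v : List α) : Prop := v ≠ [] ∧ v.Palindrome ∧ v <:+: s

/-- `prelen s i`: length of the longest palindromic prefix of `s[i..|s|]`. -/
def prelen (s : List α) (i : ℕ) : ℕ :=
  sSup {l | 1 ≤ l ∧ l ≤ s.length + 1 - i ∧ (substr s i (i + l - 1)).Palindrome}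

/-- `suflen s i`: length of the longest palindromic suffix of `s[1..i]`. -/
def suflen (s : List α) (i : ℕ) : ℕ :=
  sSup {l | 1 ≤ l ∧ l ≤ i ∧ (substr s (i + 1 - l) i).Palindrome}

/-- longest palindromic prefix of `s[i..|s|]`. -/
def prepal (s : List α) (i : ℕ) : List α := substr s i (i + prelen s i - 1)

/-- longest palindromic suffix of `s[1..i]`. -/
def sufpal (s : List α) (i : ℕ) : List α := substr s (i + 1 - suflen s i) i

/-- The occurrence `s[i..j]` is a surface in `s`. -/
def Surface (s : List α) (i j : ℕ) : Prop :=
  1 ≤ i ∧ i ≤ j ∧ j ≤ s.length ∧ (substr s i j).Palindrome ∧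
    (∀ l, 1 ≤ l → l < i → ¬ (substr s l j).Palindrome) ∧
    (∀ r, j < r → r ≤ s.length → ¬ (substr s i r).Palindrome)

/-- length of the longest proper palindromic suffix of `t`. -/
def linklen (t : List α) : ℕ :=
  sSup {l | l < t.length ∧ (t.drop (t.length - l)).Palindrome}

/-- the longest proper palindromic suffix of `t` (possibly `[]`). -/
def link (t : List α) : List α := t.drop (t.length - linklen t)

/-- `overline-occ`: shifted occurrences `{i + |t| - |link t| : i ∈ occ s t}`. -/
def obar (s t : List α) : Set ℕ := (fun i => i + t.length - (link t).length) '' occ s t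

/-- Eq.(★): the family `S` of reduced occurrence sets represents `occ` for `s`. -/
def SatStar (s : List α) (S : List α → Set ℕ) : Prop :=
  ∀ v, IsPalSub s v →
    occ s v = S v ∪ ⋃ u ∈ {u : List α | IsPalSub s u ∧ link u = v}, (occ s u ∪ obar s u)

/-- number of non-empty palindromic substrings of `s` linking to `v`. -/
def linkcnt (s v : List α) : ℕ := {u | IsPalSub s u ∧ link u = v}.ncard

def precnt (s v : List α) : ℕ := {i | 1 ≤ i ∧ i ≤ s.length ∧ prepal s i = v}.ncard

def sufcnt (s v : List α) : ℕ := {i | 1 ≤ i ∧ i ≤ s.length ∧ sufpal s i = v}.ncard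

def cnt (s v : List α) : ℕ := sufcnt s v

/-- surfaced occurrences of `v` in `s`. -/
def surf (s v : List α) : Set ℕ := {i ∈ occ s v | Surface s i (i + v.length - 1)}

def presurf (s : List α) (i : ℕ) : List α :=
  if Surface s i (i + prelen s i - 1) then prepal s i else []

def sufsurf (s : List α) (i : ℕ) : List α :=
  if Surface s (i + 1 - suflen s i) i then sufpal s i else []

end DEE
namespace DEE

theorem mem_occ_iff {α : Type*} {s t : List α} {i : ℕ} (ht : t ≠ []) :
    i ∈ occ s t ↔ 1 ≤ i ∧ t <+: s.drop (i - 1) := by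
  have hpos := List.length_pos_iff.mpr ht
  constructor
  · rintro ⟨h1, -, h3⟩
    exact ⟨h1, h3 ▸ List.take_prefix _ _⟩
  · rintro ⟨h1, h2⟩
    have hlen := h2.length_le
    rw [List.length_drop] at hlen
    exact ⟨h1, by omega, (List.prefix_iff_eq_take.mp h2).symm⟩

theorem mem_occ_tail_iff {α : Type*} {s t : List α} {i : ℕ} (ht : t ≠ []) :
    i ∈ occ s.tail t ↔ 1 ≤ i ∧ i + 1 ∈ occ s t := by
  rw [mem_occ_iff ht, mem_occ_iff ht, List.drop_tail]
  constructor
  · rintro ⟨h1, h2⟩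
    exact ⟨h1, by omega, by rwa [Nat.sub_add_cancel h1] at h2⟩
  · rintro ⟨h1, -, h2⟩
    exact ⟨h1, by rwa [Nat.sub_add_cancel h1]⟩

theorem isInfix_of_mem_occ {α : Type*} {s t : List α} {i : ℕ} (ht : t ≠ [])
    (h : i ∈ occ s t) : t <:+: s :=
  ((mem_occ_iff ht).mp h).2.isInfix.trans (List.drop_suffix _ _).isInfix

theorem IsPalSub.of_tail {α : Type*} {s v : List α} (h : IsPalSub s.tail v) : IsPalSub s v :=
  ⟨h.1, h.2.1, h.2.2.trans (List.tail_suffix s).isInfix⟩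

theorem linklen_mem {α : Type*} {t : List α} (ht : t ≠ []) :
    linklen t ∈ {l | l < t.length ∧ (t.drop (t.length - l)).Palindrome} := by
  refine Nat.sSup_mem ⟨0, List.length_pos_iff.mpr ht, ?_⟩ ⟨t.length, fun l hl => hl.1.le⟩
  simpa using List.Palindrome.nil

theorem link_palindrome {α : Type*} {t : List α} (ht : t ≠ []) : (link t).Palindrome :=
  (linklen_mem ht).2

theorem length_link {α : Type*} {t : List α} (ht : t ≠ []) : (link t).length = linklen t := by
  have h := (linklen_mem ht).1
  rw [link, List.length_drop]
  omega

theorem length_link_lt {α : Type*} {t : List α} (ht : t ≠ []) :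
    (link t).length < t.length :=
  length_link ht ▸ (linklen_mem ht).1

theorem link_suffix {α : Type*} (t : List α) : link t <:+ t := List.drop_suffix _ _

theorem length_le_length_link {α : Type*} {t p : List α} (hp : p.Palindrome) (hpt : p <:+ t)
    (hlt : p.length < t.length) : p.length ≤ (link t).length := by
  have ht : t ≠ [] := by rintro rfl; simp at hlt
  rw [length_link ht]
  refine le_csSup ⟨t.length, fun l hl => hl.1.le⟩ ⟨hlt, ?_⟩
  rwa [← List.suffix_iff_eq_drop.mp hpt]

theorem suffix_of_prefix_of_palindrome {α : Type*} {p t : List α} (hp : p.Palindrome)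
    (ht : t.Palindrome) (h : p <+: t) : p <:+ t := by
  rwa [← List.reverse_prefix, hp.reverse_eq, ht.reverse_eq]

theorem prefix_of_suffix_of_palindrome {α : Type*} {p t : List α} (hp : p.Palindrome)
    (ht : t.Palindrome) (h : p <:+ t) : p <+: t := by
  rwa [← List.reverse_suffix, hp.reverse_eq, ht.reverse_eq]

theorem link_prefix {α : Type*} {t : List α} (ht : t ≠ []) (hp : t.Palindrome) :
    link t <+: t :=
  prefix_of_suffix_of_palindrome (link_palindrome ht) hp (link_suffix t)

/-- The shortest palindromic prefix that is longer than the palindromic prefix `v` links to `v`. -/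
theorem exists_link_eq {α : Type*} {r v x : List α} (hv : v.Palindrome) (hvr : v <+: r)
    (hx : x.Palindrome) (hxr : x <+: r) (hlt : v.length < x.length) :
    ∃ u : List α, u ≠ [] ∧ u.Palindrome ∧ u <+: r ∧ link u = v := by
  classical
  have hex : ∃ n, ∃ u : List α, u.length = n ∧ u.Palindrome ∧ u <+: r ∧ v.length < u.length :=
    ⟨_, x, rfl, hx, hxr, hlt⟩
  obtain ⟨u, hun, hu, hur, hvu⟩ := Nat.find_spec hex
  have hne : u ≠ [] := by rintro rfl; simp at hvu
  have hvu' : v <+: u := List.prefix_of_prefix_length_le hvr hur hvu.le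
  have hle := length_le_length_link hv (suffix_of_prefix_of_palindrome hv hu hvu') hvu
  have hlink : link u <+: r := (link_prefix hne hu).trans hur
  refine ⟨u, hne, hu, hur, ?_⟩
  refine ((List.prefix_of_prefix_length_le hvr hlink hle).eq_of_length_le ?_).symm
  by_contra! hcon
  have hmin := Nat.find_min' hex ⟨link u, rfl, link_palindrome hne, hlink, hcon⟩
  have := length_link_lt hne
  omega

theorem palindrome_take_drop {α : Type*} {w : List α} (hw : w.Palindrome) (d : ℕ) :
    ((w.drop d).take (w.length - 2 * d)).Palindrome := by
  apply List.Palindrome.of_reverse_eq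
  rw [List.reverse_take, List.reverse_drop, hw.reverse_eq, List.length_drop, List.drop_take]
  by_cases h : 2 * d ≤ w.length
  · rw [show w.length - d - (w.length - 2 * d) = d by omega,
      show w.length - d - d = w.length - 2 * d by omega]
  · rw [show w.length - 2 * d = 0 by omega, Nat.sub_zero, Nat.sub_self, List.take_zero,
      List.take_zero]

theorem palindrome_of_border {α : Type*} {b u : List α} (hu : u.Palindrome) (hpre : b <+: u)
    (hsuf : b <:+ u) : b.Palindrome := by
  apply List.Palindrome.of_reverse_eq
  rw [← List.reverse_prefix, hu.reverse_eq] at hsuf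
  exact (List.prefix_of_prefix_length_le hsuf hpre (by simp)).eq_of_length (by simp)

/-- If `u` is a proper palindromic prefix of a palindrome `w`, then the suffix occurrence of
`link u` in the prefix `u` is a proper prefix of some palindrome inside `w`. -/
theorem exists_longer_palindrome {α : Type*} {u w : List α} (hne : u ≠ []) (hu : u.Palindrome)
    (hw : w.Palindrome) (huw : u <+: w) (hlt : u.length < w.length) :
    ∃ x : List α, x.Palindrome ∧ x <+: w.drop (u.length - (link u).length) ∧
      (link u).length < x.length := by
  have hl := length_link_lt hne
  have hsuf := suffix_of_prefix_of_palindrome hu hw huw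
  rcases lt_trichotomy (w.length - u.length) (u.length - (link u).length) with h | h | h
  · exfalso
    have hdrop : u.drop (w.length - u.length) <+: u := by
      have h1 := huw.drop (w.length - u.length)
      rw [← List.suffix_iff_eq_drop.mp hsuf] at h1
      exact h1
    have hpal := palindrome_of_border hu hdrop (List.drop_suffix _ _)
    have hle := length_le_length_link hpal (List.drop_suffix _ _)
      (by rw [List.length_drop]; omega)
    rw [List.length_drop] at hle
    omega
  · refine ⟨u, hu, ?_, hl⟩
    rw [← h, ← List.suffix_iff_eq_drop.mp hsuf]
  · refine ⟨_, palindrome_take_drop hw _, List.take_prefix _ _, ?_⟩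
    rw [List.length_take, List.length_drop]
    omega

theorem substr_one {α : Type*} (s : List α) (l : ℕ) : substr s 1 l = s.take l := by
  simp [substr]

theorem prelen_one_mem {α : Type*} {s : List α} (hs : s ≠ []) :
    prelen s 1 ∈ {l | 1 ≤ l ∧ l ≤ s.length + 1 - 1 ∧ (substr s 1 (1 + l - 1)).Palindrome} := by
  refine Nat.sSup_mem ⟨1, le_rfl, ?_, ?_⟩ ⟨s.length, fun l hl => hl.2.1⟩
  · exact List.length_pos_iff.mpr hs
  · obtain ⟨a, t, rfl⟩ := List.exists_cons_of_ne_nil hs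
    simpa [substr] using List.Palindrome.singleton a

theorem prepal_one_eq_take {α : Type*} (s : List α) : prepal s 1 = s.take (prelen s 1) := by
  rw [prepal, substr_one, Nat.add_sub_cancel_left]

theorem prepal_one_prefix {α : Type*} (s : List α) : prepal s 1 <+: s :=
  prepal_one_eq_take s ▸ List.take_prefix _ _

theorem prepal_one_palindrome {α : Type*} {s : List α} (hs : s ≠ []) :
    (prepal s 1).Palindrome :=
  (prelen_one_mem hs).2.2

theorem prepal_one_ne_nil {α : Type*} {s : List α} (hs : s ≠ []) : prepal s 1 ≠ [] := by
  have h := (prelen_one_mem hs).1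
  rw [prepal_one_eq_take, Ne, List.take_eq_nil_iff]
  rintro (h0 | h0)
  · omega
  · exact hs h0

theorem length_le_length_prepal_one {α : Type*} {s u : List α} (hne : u ≠ [])
    (hu : u.Palindrome) (hus : u <+: s) : u.length ≤ (prepal s 1).length := by
  rw [prepal_one_eq_take, List.length_take]
  refine le_min (le_csSup ⟨s.length, fun l hl => hl.2.1⟩ ⟨List.length_pos_iff.mpr hne, ?_, ?_⟩)
    hus.length_le
  · simpa using hus.length_le
  · rwa [substr_one, Nat.add_sub_cancel_left, ← List.prefix_iff_eq_take.mp hus]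

theorem mem_obar_iff {α : Type*} {s t : List α} {j : ℕ} :
    j ∈ obar s t ↔ ∃ i ∈ occ s t, i + t.length - (link t).length = j := Iff.rfl

theorem obar_subset_occ_link {α : Type*} {s u : List α} (hne : u ≠ []) (hlink : link u ≠ []) :
    obar s u ⊆ occ s (link u) := by
  rintro j ⟨i, hi, rfl⟩
  obtain ⟨h1, h2⟩ := (mem_occ_iff hne).mp hi
  have hl := length_link_lt hne
  refine (mem_occ_iff hlink).mpr ⟨by dsimp only; omega, ?_⟩
  have h3 := h2.drop (u.length - (link u).length)
  rw [← List.suffix_iff_eq_drop.mp (link_suffix u), List.drop_drop] at h3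
  convert h3 using 2
  dsimp only
  omega

/-- The suffix occurrence of `link u` in a palindromic prefix `u` of `s` other than the longest one
starts an occurrence of some palindrome with the same link. -/
theorem exists_occ_of_prefix_ne_prepal {α : Type*} {s u : List α} (hne : u ≠ [])
    (hu : u.Palindrome) (hus : u <+: s) (hup : u ≠ prepal s 1) :
    ∃ x : List α, x ≠ [] ∧ x.Palindrome ∧ link x = link u ∧
      x <+: s.drop (u.length - (link u).length) := by
  have hs : s ≠ [] := by rintro rfl; exact hne (List.prefix_nil.mp hus)
  have hle := length_le_length_prepal_one hne hu hus
  have hpre := List.prefix_of_prefix_length_le hus (prepal_one_prefix s) hle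
  have hlt : u.length < (prepal s 1).length :=
    lt_of_le_of_ne hle fun h => hup (hpre.eq_of_length h)
  obtain ⟨y, hy, hyp, hyl⟩ := exists_longer_palindrome hne hu (prepal_one_palindrome hs) hpre hlt
  have hlu : link u <+: s.drop (u.length - (link u).length) := by
    have h := hus.drop (u.length - (link u).length)
    rwa [← List.suffix_iff_eq_drop.mp (link_suffix u)] at h
  obtain ⟨x, hx0, hx, hxp, hxl⟩ := exists_link_eq (link_palindrome hne) hlu hy
    (hyp.trans ((prepal_one_prefix s).drop _)) hyl
  exact ⟨x, hx0, hx, hxl, hxp⟩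

end DEE

/-- (`pop_front` correctness.) Let `v'` be the longest palindromic
prefix of non-empty `s` and `s' = s[2..|s|]`. Removing position `1` from each `S(v)`,
inserting `|v'| - |link v'| + 1` into `S(link v')` when `|link v'| ≥ 1`, and shifting all
positions left by one, yields a family satisfying Eq.(★) for `s'`. -/
theorem pop_front_occurrence_recording {α : Type*} (s : List α) (hs : s ≠ [])
    (S : List α → Set ℕ) (hS : DEE.SatStar s S) :
    DEE.SatStar s.tail
      (fun v =>
        if v = DEE.link (DEE.prepal s 1) ∧ 1 ≤ (DEE.link (DEE.prepal s 1)).length then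
          (· - 1) ''
            ((S v \ {1}) ∪
              {(DEE.prepal s 1).length - (DEE.link (DEE.prepal s 1)).length + 1})
        else (· - 1) '' (S v \ {1})) := by
  intro v hv
  have hstar := hS v hv.of_tail
  have hpal := DEE.prepal_one_ne_nil hs
  have hlt := DEE.length_link_lt hpal
  have hsub : S v ⊆ DEE.occ s v := hstar ▸ Set.subset_union_left
  ext j
  constructor
  · intro hj
    obtain ⟨hj1, hj2⟩ := (DEE.mem_occ_tail_iff hv.1).mp hj
    rw [hstar] at hj2
    simp only [Set.mem_union, Set.mem_iUnion, Set.mem_ofPred_eq, exists_prop] at hj2 ⊢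
    rcases hj2 with hj2 | ⟨u, ⟨hu, rfl⟩, hj2 | hj2⟩
    · left
      split_ifs
      · exact ⟨j + 1, Or.inl ⟨hj2, by simp; omega⟩, by simp⟩
      · exact ⟨j + 1, ⟨hj2, by simp; omega⟩, by simp⟩
    · have hocc := (DEE.mem_occ_tail_iff hu.1).mpr ⟨hj1, hj2⟩
      exact Or.inr ⟨u, ⟨⟨hu.1, hu.2.1, DEE.isInfix_of_mem_occ hu.1 hocc⟩, rfl⟩, Or.inl hocc⟩
    · obtain ⟨i, hi, hij⟩ := DEE.mem_obar_iff.mp hj2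
      have hlu := DEE.length_link_lt hu.1
      obtain ⟨hi1, hi2⟩ := (DEE.mem_occ_iff hu.1).mp hi
      rcases hi1.eq_or_lt with rfl | hi1
      · rw [Nat.sub_self, List.drop_zero] at hi2
        by_cases hup : u = DEE.prepal s 1
        · left
          subst hup
          rw [if_pos ⟨rfl, List.length_pos_iff.mpr hv.1⟩]
          exact ⟨_, Or.inr rfl, by dsimp only; omega⟩
        · right
          obtain ⟨x, hx0, hx, hxl, hxp⟩ :=
            DEE.exists_occ_of_prefix_ne_prepal hu.1 hu.2.1 hi2 hup
          have hocc : j ∈ DEE.occ s.tail x := by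
            rw [DEE.mem_occ_tail_iff hx0, DEE.mem_occ_iff hx0]
            refine ⟨hj1, by omega, ?_⟩
            convert hxp using 2
            omega
          exact ⟨x, ⟨⟨hx0, hx, DEE.isInfix_of_mem_occ hx0 hocc⟩, hxl⟩, Or.inl hocc⟩
      · have hocc : i - 1 ∈ DEE.occ s.tail u :=
          (DEE.mem_occ_tail_iff hu.1).mpr ⟨by omega, by rwa [Nat.sub_add_cancel hi1.le]⟩
        exact Or.inr ⟨u, ⟨⟨hu.1, hu.2.1, DEE.isInfix_of_mem_occ hu.1 hocc⟩, rfl⟩,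
          Or.inr (DEE.mem_obar_iff.mpr ⟨i - 1, hocc, by omega⟩)⟩
  · have hshift : ∀ x ∈ DEE.occ s v, x ≠ 1 → x - 1 ∈ DEE.occ s.tail v := by
      intro x hx hx1
      have := hx.1
      exact (DEE.mem_occ_tail_iff hv.1).mpr ⟨by omega, by rwa [Nat.sub_add_cancel hx.1]⟩
    intro hj
    simp only [Set.mem_union, Set.mem_iUnion, Set.mem_ofPred_eq, exists_prop] at hj
    rcases hj with hj | ⟨u, ⟨hu, rfl⟩, hj⟩
    · split_ifs at hj with hcond
      · obtain ⟨x, hx | rfl, rfl⟩ := hj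
        · exact hshift x (hsub hx.1) hx.2
        · refine hshift _ ?_ (by omega)
          obtain ⟨rfl, -⟩ := hcond
          refine DEE.obar_subset_occ_link hpal hv.1 (DEE.mem_obar_iff.mpr ⟨1, ?_, by omega⟩)
          exact (DEE.mem_occ_iff hpal).mpr ⟨le_rfl, DEE.prepal_one_prefix s⟩
      · obtain ⟨x, hx, rfl⟩ := hj
        exact hshift x (hsub hx.1) hx.2
    · rcases hj with hj | hj
      · obtain ⟨h1, h2⟩ := (DEE.mem_occ_iff hu.1).mp hj
        exact (DEE.mem_occ_iff hv.1).mpr ⟨h1, (DEE.link_prefix hu.1 hu.2.1).trans h2⟩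
      · exact DEE.obar_subset_occ_link hu.1 hv.1 hj
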